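/- Unbiasedness of the product count-sketch estimator of a matrix entry (used for the unbiasedness claim of CodedSketch): for every (i,j) ∈ Fin m × Fin n, E[ ĉ_{i,j} ] = M_{i,j}. -/

import Mathlib

open MeasureTheory ProbabilityTheory
open scoped ENNReal

/-- If `X` is independent of `(Y, Z)` and `Y` is independent of `Z`, then `(X, Y)` is independent
of `Z`. -/
theorem indepFun_prodMk_left_of_prodMk_right {Ω α β γ : Type*} [MeasurableSpace Ω]
    [MeasurableSpace α] [MeasurableSpace β] [MeasurableSpace γ] {P : Measure Ω}
    [IsProbabilityMeasure P] {X : Ω → α} {Y : Ω → β} {Z : Ω → γ}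
    (hX : Measurable X) (hY : Measurable Y) (hZ : Measurable Z)
    (hXYZ : IndepFun X (fun ω => (Y ω, Z ω)) P) (hYZ : IndepFun Y Z P) :
    IndepFun (fun ω => (X ω, Y ω)) Z P := by
  have := Measure.isProbabilityMeasure_map (μ := P) hX.aemeasurable
  have := Measure.isProbabilityMeasure_map (μ := P) hY.aemeasurable
  have := Measure.isProbabilityMeasure_map (μ := P) hZ.aemeasurable
  have hXY : IndepFun X Y P := hXYZ.comp measurable_id measurable_fst
  rw [indepFun_iff_map_prod_eq_prod_map_map (by fun_prop) (by fun_prop)] at hXYZ hYZ hXY ⊢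
  rw [hYZ] at hXYZ
  rw [hXY, ← (measurePreserving_prodAssoc _ _ _).symm.map_eq, ← hXYZ,
    Measure.map_map (by fun_prop) (by fun_prop)]
  rfl

/-- A random sign that is `1` with probability `1 / 2` has mean zero. -/
theorem integral_sign_eq_zero {Ω : Type*} [MeasurableSpace Ω] {P : Measure Ω}
    [IsProbabilityMeasure P] {s : Ω → ℝ} (hs : Measurable s)
    (hval : ∀ ω, s ω = 1 ∨ s ω = -1) (hunif : P {ω | s ω = 1} = 1 / 2) :
    ∫ ω, s ω ∂P = 0 := by
  have hmeas : MeasurableSet {ω | s ω = 1} := hs (measurableSet_singleton 1)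
  have hs_eq : s = fun ω => 2 * {ω | s ω = 1}.indicator 1 ω - 1 := by
    funext ω
    rcases hval ω with h | h <;> norm_num [Set.indicator, h]
  have hint : Integrable ({ω | s ω = 1}.indicator (1 : Ω → ℝ)) P :=
    (integrable_const 1).indicator hmeas
  rw [hs_eq, integral_sub (hint.const_mul 2) (integrable_const 1), integral_const_mul,
    integral_indicator_one hmeas]
  simp [measureReal_def, hunif]

/-- Pairwise independent uniform random signs are orthonormal. -/
theorem integral_sign_mul_sign {Ω ι : Type*} [MeasurableSpace Ω] [DecidableEq ι] {P : Measure Ω}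
    [IsProbabilityMeasure P] {s : Ω → ι → ℝ} (hs : Measurable s)
    (hval : ∀ ω i, s ω i = 1 ∨ s ω i = -1) (hunif : ∀ i, P {ω | s ω i = 1} = 1 / 2)
    (hpair : ∀ i i', i ≠ i' → IndepFun (fun ω => s ω i) (fun ω => s ω i') P) (i i' : ι) :
    ∫ ω, s ω i * s ω i' ∂P = if i = i' then 1 else 0 := by
  have hsi (k : ι) : Measurable fun ω => s ω k := (measurable_pi_apply k).comp hs
  split_ifs with h
  · subst h
    have hsq (ω : Ω) : s ω i * s ω i = 1 := by rcases hval ω i with h | h <;> norm_num [h]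
    simp [hsq]
  · rw [(hpair i i' h).integral_fun_mul_eq_mul_integral (hsi i).aestronglyMeasurable
      (hsi i').aestronglyMeasurable,
      integral_sign_eq_zero (hsi i) (fun ω => hval ω i) (hunif i), zero_mul]

/-- Unbiasedness of the product count-sketch estimator of a matrix entry (used for the
unbiasedness claim of CodedSketch): for every `(i,j)`, `E[ ĉ i j ] = M i j`, where
`ĉ i j ω = s₁(i)s₂(j) · ∑_{(i',j') : h₁(i')+h₂(j') = h₁(i)+h₂(j)} s₁(i')s₂(j') M i' j'`
(hash values added as integers). Mutual independence of the quadruple `(h₁,h₂,s₁,s₂)`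
is expressed by the chain conditions `hmut₁`, `hmut₂`, `hmut₃`. -/
theorem product_countSketch_unbiased
    {Ω : Type*} [MeasurableSpace Ω] (P : Measure Ω) [IsProbabilityMeasure P]
    {m n b : ℕ} (hm : 1 ≤ m) (hn : 1 ≤ n) (hb : 1 ≤ b)
    (M : Matrix (Fin m) (Fin n) ℝ)
    (h₁ : Ω → Fin m → Fin b) (h₂ : Ω → Fin n → Fin b)
    (s₁ : Ω → Fin m → ℝ) (s₂ : Ω → Fin n → ℝ)
    (hm₁ : Measurable h₁) (hm₂ : Measurable h₂) (hm₃ : Measurable s₁) (hm₄ : Measurable s₂)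
    (hval₁ : ∀ ω i, s₁ ω i = 1 ∨ s₁ ω i = -1)
    (hval₂ : ∀ ω j, s₂ ω j = 1 ∨ s₂ ω j = -1)
    (hhunif₁ : ∀ (i : Fin m) (x : Fin b), P {ω | h₁ ω i = x} = 1 / (b : ℝ≥0∞))
    (hhunif₂ : ∀ (j : Fin n) (x : Fin b), P {ω | h₂ ω j = x} = 1 / (b : ℝ≥0∞))
    (hhpair₁ : ∀ i i' : Fin m, i ≠ i' → IndepFun (fun ω => h₁ ω i) (fun ω => h₁ ω i') P)
    (hhpair₂ : ∀ j j' : Fin n, j ≠ j' → IndepFun (fun ω => h₂ ω j) (fun ω => h₂ ω j') P)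
    (hsunif₁ : ∀ i : Fin m, P {ω | s₁ ω i = 1} = 1 / 2)
    (hsunif₂ : ∀ j : Fin n, P {ω | s₂ ω j = 1} = 1 / 2)
    (hspair₁ : ∀ i i' : Fin m, i ≠ i' → IndepFun (fun ω => s₁ ω i) (fun ω => s₁ ω i') P)
    (hspair₂ : ∀ j j' : Fin n, j ≠ j' → IndepFun (fun ω => s₂ ω j) (fun ω => s₂ ω j') P)
    (hmut₁ : IndepFun h₁ (fun ω => (h₂ ω, s₁ ω, s₂ ω)) P)
    (hmut₂ : IndepFun h₂ (fun ω => (s₁ ω, s₂ ω)) P)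
    (hmut₃ : IndepFun s₁ s₂ P)
    (c : Fin m → Fin n → Ω → ℝ)
    (hc : ∀ i j ω, c i j ω = s₁ ω i * s₂ ω j *
      ∑ q ∈ Finset.univ.filter (fun q : Fin m × Fin n =>
          (h₁ ω q.1 : ℕ) + (h₂ ω q.2 : ℕ) = (h₁ ω i : ℕ) + (h₂ ω j : ℕ)),
        s₁ ω q.1 * s₂ ω q.2 * M q.1 q.2)
    (i : Fin m) (j : Fin n) :
    ∫ ω, c i j ω ∂P = M i j := by
  have hindep : IndepFun (fun ω => (h₁ ω, h₂ ω)) (fun ω => (s₁ ω, s₂ ω)) P :=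
    indepFun_prodMk_left_of_prodMk_right hm₁ hm₂ (hm₃.prodMk hm₄) hmut₁ hmut₂
  have hs₁ (k : Fin m) : Measurable fun ω => s₁ ω k := (measurable_pi_apply k).comp hm₃
  have hs₂ (k : Fin n) : Measurable fun ω => s₂ ω k := (measurable_pi_apply k).comp hm₄
  let collide (q : Fin m × Fin n) (x : (Fin m → Fin b) × (Fin n → Fin b)) : ℝ :=
    if (x.1 q.1 : ℕ) + (x.2 q.2 : ℕ) = (x.1 i : ℕ) + (x.2 j : ℕ) then 1 else 0
  let sign (q : Fin m × Fin n) (y : (Fin m → ℝ) × (Fin n → ℝ)) : ℝ :=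
    (y.1 i * y.1 q.1) * (y.2 j * y.2 q.2)
  have hcollide (q) : Measurable (collide q) := measurable_of_finite _
  have hsign (q) : Measurable (sign q) := by fun_prop
  have hcollide_comp (q) : Measurable fun ω => collide q (h₁ ω, h₂ ω) :=
    (hcollide q).comp (hm₁.prodMk hm₂)
  have hsign_comp (q) : Measurable fun ω => sign q (s₁ ω, s₂ ω) :=
    (hsign q).comp (hm₃.prodMk hm₄)
  have hc_eq (ω : Ω) : c i j ω =
      ∑ q, collide q (h₁ ω, h₂ ω) * sign q (s₁ ω, s₂ ω) * M q.1 q.2 := by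
    rw [hc, Finset.sum_filter, Finset.mul_sum]
    refine Finset.sum_congr rfl fun q _ => ?_
    simp only [collide, sign]
    split_ifs <;> ring
  have hint (q) : Integrable
      (fun ω => collide q (h₁ ω, h₂ ω) * sign q (s₁ ω, s₂ ω) * M q.1 q.2) P := by
    refine Integrable.mul_const (Integrable.of_bound
      ((hcollide_comp q).mul (hsign_comp q)).aestronglyMeasurable 1 (ae_of_all _ fun ω => ?_)) _
    have habs₁ (k) : |s₁ ω k| = 1 := by rcases hval₁ ω k with h | h <;> simp [h]
    have habs₂ (k) : |s₂ ω k| = 1 := by rcases hval₂ ω k with h | h <;> simp [h]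
    simp only [Pi.mul_apply, collide, sign, Real.norm_eq_abs, abs_mul, habs₁, habs₂]
    split_ifs <;> simp
  have hsign_integral (q : Fin m × Fin n) :
      ∫ ω, sign q (s₁ ω, s₂ ω) ∂P = if q = (i, j) then 1 else 0 := by
    have hprod : IndepFun (fun ω => s₁ ω i * s₁ ω q.1) (fun ω => s₂ ω j * s₂ ω q.2) P :=
      hmut₃.comp (φ := fun y : Fin m → ℝ => y i * y q.1)
        (ψ := fun y : Fin n → ℝ => y j * y q.2)
        (by fun_prop) (by fun_prop)
    simp only [sign]
    rw [hprod.integral_fun_mul_eq_mul_integral ((hs₁ i).mul (hs₁ q.1)).aestronglyMeasurable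
      ((hs₂ j).mul (hs₂ q.2)).aestronglyMeasurable,
      integral_sign_mul_sign hm₃ hval₁ hsunif₁ hspair₁,
      integral_sign_mul_sign hm₄ hval₂ hsunif₂ hspair₂]
    simp [Prod.ext_iff, ← ite_and, and_comm, eq_comm]
  have hterm (q : Fin m × Fin n) :
      ∫ ω, collide q (h₁ ω, h₂ ω) * sign q (s₁ ω, s₂ ω) * M q.1 q.2 ∂P =
        if q = (i, j) then M i j else 0 := by
    have hfactor : IndepFun (fun ω => collide q (h₁ ω, h₂ ω)) (fun ω => sign q (s₁ ω, s₂ ω)) P :=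
      hindep.comp (hcollide q) (hsign q)
    rw [integral_mul_const, hfactor.integral_fun_mul_eq_mul_integral
      (hcollide_comp q).aestronglyMeasurable (hsign_comp q).aestronglyMeasurable,
      hsign_integral]
    split_ifs with h
    · simp [h, collide]
    · simp
  simp_rw [hc_eq]
  rw [integral_finsetSum _ fun q _ => hint q]
  simp [hterm]
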